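/- For every x ≠ 0 and every δ > 0, the approximation error of the normalized L²-norm function to the sign function satisfies the explicit bound |x/√(δ + x²) − sgn(x)| ≤ δ/(2x²). -/

import Mathlib

/-- The error bound on the positive half-line, where the sign is `1`. -/
lemma abs_div_sqrt_sub_one_le {x δ : ℝ} (hx : 0 < x) (hδ : 0 < δ) :
    |x / Real.sqrt (δ + x ^ 2) - 1| ≤ δ / (2 * x ^ 2) := by
  have hsq : Real.sqrt (δ + x ^ 2) ^ 2 = δ + x ^ 2 := Real.sq_sqrt (by positivity)
  have hle : x ≤ Real.sqrt (δ + x ^ 2) := Real.le_sqrt_of_sq_le (by linarith)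
  set s := Real.sqrt (δ + x ^ 2)
  have hs : 0 < s := hx.trans_le hle
  rw [abs_sub_comm, abs_of_nonneg (sub_nonneg.2 ((div_le_one hs).2 hle)), one_sub_div hs.ne',
    div_le_div_iff₀ hs (by positivity), show δ = (s - x) * (s + x) by linarith, mul_assoc]
  exact mul_le_mul_of_nonneg_left (by nlinarith) (sub_nonneg.2 hle)

/-- For every `x ≠ 0` and `δ > 0`, the approximation error of the normalized
`L²`-norm function to the sign function satisfies
`|x / √(δ + x²) − sgn x| ≤ δ / (2 x²)`. -/
theorem normalizedL2_error_bound (x : ℝ) (hx : x ≠ 0) (δ : ℝ) (hδ : 0 < δ) :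
    |x / Real.sqrt (δ + x ^ 2) - Real.sign x| ≤ δ / (2 * x ^ 2) := by
  rcases hx.lt_or_gt with h | h
  · have key := abs_div_sqrt_sub_one_le (neg_pos.2 h) hδ
    rw [neg_sq, ← abs_neg] at key
    rw [Real.sign_of_neg h]
    convert key using 2
    ring
  · rw [Real.sign_of_pos h]
    exact abs_div_sqrt_sub_one_le h hδ
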